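/- Let T be a finite tree on at least 2 vertices. For every integer L > |T| there exists a constant C(L) < ∞ such that for every t ≥ 1, Σ_{i=L}^∞ P(D_i(T) > t) ≤ C(L) · t^{3−2L} · exp(−t²/4). -/

import Mathlib

open MeasureTheory Filter Real
open scoped ENNReal

noncomputable section

/-- The degree of vertex `v` in a graph on `ℕ`. -/
def degN (G : SimpleGraph ℕ) (v : ℕ) : ℕ := (G.neighborSet v).ncard

/-- `G` is a tree on the vertex set `{0, …, k-1}` (all other vertices isolated). -/
def IsTreeOn (k : ℕ) (G : SimpleGraph ℕ) : Prop :=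
  (∀ v w : ℕ, G.Adj v w → v < k ∧ w < k) ∧ (G.induce {v : ℕ | v < k}).IsTree

instance : MeasurableSpace (SimpleGraph ℕ) := ⊤

/-- Add the edge `uv` to `G`. -/
def addEdge (G : SimpleGraph ℕ) (u v : ℕ) : SimpleGraph ℕ :=
  G ⊔ SimpleGraph.fromEdgeSet {s(u, v)}

/-- One step of preferential attachment: the current graph has `n` vertices `0, …, n-1`;
the new vertex `n` attaches to an existing vertex `v` with probability `deg v / (2(n-1))`. -/
def paStep (n : ℕ) (G : SimpleGraph ℕ) : Measure (SimpleGraph ℕ) :=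
  Measure.sum fun v : ℕ =>
    ((degN G v : ℝ≥0∞) / ((2 * (n - 1) : ℕ) : ℝ≥0∞)) • Measure.dirac (addEdge G n v)

def PAlawAux (k : ℕ) (T : SimpleGraph ℕ) : ℕ → Measure (SimpleGraph ℕ)
  | 0 => Measure.dirac T
  | m + 1 => (PAlawAux k T m).bind (paStep (k + m))

/-- The law of `PA(n, T)` for a seed tree `T` on `k` vertices, as a measure on labelled
graphs on `ℕ` (vertices are labelled `0, 1, 2, …` in order of arrival). -/
def PAlaw (k : ℕ) (T : SimpleGraph ℕ) (n : ℕ) : Measure (SimpleGraph ℕ) :=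
  PAlawAux k T (n - k)

/-- Graphs on `ℕ` up to isomorphism. -/
def graphSetoid : Setoid (SimpleGraph ℕ) where
  r G H := Nonempty (G ≃g H)
  iseqv := ⟨fun G => ⟨RelIso.refl G.Adj⟩, fun ⟨e⟩ => ⟨e.symm⟩, fun ⟨e⟩ ⟨f⟩ => ⟨e.trans f⟩⟩

/-- Isomorphism types of graphs on `ℕ`. -/
def GraphType : Type := Quotient graphSetoid

instance : MeasurableSpace GraphType := ⊤

/-- The law of the isomorphism type of `PA(n, T)`. -/
def PAtype (k : ℕ) (T : SimpleGraph ℕ) (n : ℕ) : Measure GraphType :=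
  (PAlaw k T n).map (Quotient.mk graphSetoid)

/-- Total variation distance between two measures. -/
def tvDist {α : Type*} [MeasurableSpace α] (μ ν : Measure α) : ℝ :=
  ⨆ A : Set α, |(μ A).toReal - (ν A).toReal|

/-- `δ(S, T) = lim_n TV(PA(n,S), PA(n,T))`, the total variation distance being taken
between the laws of the isomorphism types.  The limit exists since the sequence is
non-increasing; we express it as a `limsup`, which agrees with the limit. -/
def deltaPA (kS : ℕ) (S : SimpleGraph ℕ) (kT : ℕ) (T : SimpleGraph ℕ) : ℝ :=
  Filter.limsup (fun n : ℕ => tvDist (PAtype kS S n) (PAtype kT T n)) Filter.atTop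



/-- A graph on `ℕ` whose edges lie in `{0, …, n-1}` and which has the degree sum of a tree
on `n` vertices. -/
def IsTreeLike (n : ℕ) (G : SimpleGraph ℕ) : Prop :=
  (∀ v w : ℕ, G.Adj v w → v < n ∧ w < n) ∧ ∑ v ∈ Finset.range n, degN G v = 2 * (n - 1)

lemma addEdge_adj (G : SimpleGraph ℕ) {u v : ℕ} (huv : u ≠ v) (a b : ℕ) :
    (addEdge G u v).Adj a b ↔ G.Adj a b ∨ (a = u ∧ b = v) ∨ (a = v ∧ b = u) := by
  simp only [addEdge, SimpleGraph.sup_adj, SimpleGraph.fromEdgeSet_adj, Set.mem_singleton_iff,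
    Sym2.eq_iff]
  constructor
  · rintro (h | ⟨h, -⟩)
    · exact Or.inl h
    · exact Or.inr h
  · rintro (h | h)
    · exact Or.inl h
    · refine Or.inr ⟨h, ?_⟩
      rcases h with ⟨rfl, rfl⟩ | ⟨rfl, rfl⟩
      · exact huv
      · exact huv.symm

namespace IsTreeLike

variable {n : ℕ} {G : SimpleGraph ℕ}

lemma degN_eq_zero (h : IsTreeLike n G) {v : ℕ} (hv : n ≤ v) : degN G v = 0 := by
  have : G.neighborSet v = ∅ := by
    ext w
    simp only [SimpleGraph.mem_neighborSet, Set.mem_empty_iff_false, iff_false]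
    intro hw
    have := (h.1 v w hw).1
    omega
  simp [degN, this]

lemma lt_of_degN_ne_zero (h : IsTreeLike n G) {v : ℕ} (hv : degN G v ≠ 0) : v < n := by
  by_contra hn
  exact hv (h.degN_eq_zero (not_lt.1 hn))

lemma finite_neighborSet (h : IsTreeLike n G) (v : ℕ) : (G.neighborSet v).Finite :=
  (Set.finite_lt_nat n).subset fun _ hw => (h.1 v _ hw).2

lemma degN_addEdge (h : IsTreeLike n G) {w : ℕ} (hw : w < n) (x : ℕ) :
    degN (addEdge G n w) x = degN G x + (if x = w then 1 else 0) + (if x = n then 1 else 0) := by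
  have hnw : n ≠ w := hw.ne'
  rcases eq_or_ne x w with rfl | hxw
  · have hset : (addEdge G n x).neighborSet x = insert n (G.neighborSet x) := by
      ext b
      simp only [SimpleGraph.mem_neighborSet, addEdge_adj G hnw, Set.mem_insert_iff]
      tauto
    have hn : n ∉ G.neighborSet x := fun hb => lt_irrefl n (h.1 x n hb).2
    rw [degN, hset, Set.ncard_insert_of_notMem hn (h.finite_neighborSet x)]
    simp [degN, hnw.symm]
  · rcases eq_or_ne x n with rfl | hxn
    · have hset : (addEdge G x w).neighborSet x = {w} := by
        ext b
        simp only [SimpleGraph.mem_neighborSet, addEdge_adj G hnw, Set.mem_singleton_iff]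
        constructor
        · rintro (hb | hb | hb)
          · exact absurd (h.1 x b hb).1 (lt_irrefl x)
          · exact hb.2
          · exact absurd hb.1 hxw
        · exact fun hb => Or.inr (Or.inl ⟨trivial, hb⟩)
      rw [degN, hset, h.degN_eq_zero le_rfl]
      simp [hxw]
    · have hset : (addEdge G n w).neighborSet x = G.neighborSet x := by
        ext b
        simp only [SimpleGraph.mem_neighborSet, addEdge_adj G hnw]
        tauto
      simp [degN, hset, hxw, hxn]

lemma addEdge (h : IsTreeLike n G) (hn : 0 < n) {w : ℕ} (hw : w < n) :
    IsTreeLike (n + 1) (addEdge G n w) := by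
  constructor
  · intro a b hab
    rw [addEdge_adj G hw.ne'] at hab
    rcases hab with hab | hab | hab
    · have := h.1 a b hab
      omega
    · omega
    · omega
  · simp only [h.degN_addEdge hw]
    rw [Finset.sum_add_distrib, Finset.sum_add_distrib, Finset.sum_range_succ, h.2,
      h.degN_eq_zero le_rfl]
    simp only [Finset.sum_ite_eq', Finset.mem_range]
    rw [if_pos (by omega), if_pos (by omega)]
    omega

end IsTreeLike

lemma IsTreeOn.isTreeLike {k : ℕ} {T : SimpleGraph ℕ} (hT : IsTreeOn k T) : IsTreeLike k T := by
  classical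
  refine ⟨hT.1, ?_⟩
  have hs : {v : ℕ | v < k} = (Finset.range k : Set ℕ) := by ext; simp
  obtain ⟨hadj, htree⟩ := hT
  have hfin : Fintype {v : ℕ | v < k} := by
    rw [hs]
    infer_instance
  have hcard : Fintype.card {v : ℕ | v < k} = k := by
    rw [← Nat.card_eq_fintype_card]
    simp [hs]
  have h1 := htree.card_edgeFinset
  have h2 := (T.induce {v : ℕ | v < k}).sum_degrees_eq_twice_card_edges
  rw [hcard] at h1
  have hdeg : ∀ v : {v : ℕ | v < k}, (T.induce {v : ℕ | v < k}).degree v = degN T v := by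
    intro v
    rw [← SimpleGraph.card_neighborSet_eq_degree, ← Nat.card_eq_fintype_card, degN,
      Nat.card_coe_set_eq]
    rw [← Set.ncard_image_of_injective _ Subtype.val_injective]
    congr 1
    ext b
    simp only [Set.mem_image, SimpleGraph.mem_neighborSet, SimpleGraph.comap_adj,
      Function.Embedding.subtype_apply, Subtype.exists, exists_and_right, exists_eq_right]
    constructor
    · rintro ⟨-, hb⟩
      exact hb
    · intro hb
      exact ⟨(hadj _ _ hb).2, hb⟩
  have h3 : ∑ v ∈ Finset.range k, degN T v = ∑ v : {v : ℕ | v < k}, degN T v := by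
    rw [← Finset.sum_subtype (Finset.range k) (by simp) (fun v => degN T v)]
  rw [h3, ← Finset.sum_congr rfl (fun v _ => hdeg v), h2]
  omega

lemma ae_bind_of_ae {α β : Type*} [MeasurableSpace α] [MeasurableSpace β]
    [DiscreteMeasurableSpace α] [DiscreteMeasurableSpace β] {μ : Measure α} {κ : α → Measure β}
    {p : β → Prop} (h : ∀ᵐ a ∂μ, ∀ᵐ b ∂κ a, p b) : ∀ᵐ b ∂μ.bind κ, p b := by
  rw [ae_iff, Measure.bind_apply (MeasurableSet.of_discrete) (Measurable.of_discrete.aemeasurable)]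
  rw [lintegral_eq_zero_iff' Measurable.of_discrete.aemeasurable]
  exact h

instance : DiscreteMeasurableSpace (SimpleGraph ℕ) := ⟨fun _ => trivial⟩

lemma ae_paStep {n : ℕ} {G : SimpleGraph ℕ} {p : SimpleGraph ℕ → Prop}
    (h : ∀ v, degN G v ≠ 0 → p (addEdge G n v)) : ∀ᵐ H ∂paStep n G, p H := by
  rw [ae_iff, paStep, Measure.sum_apply _ MeasurableSet.of_discrete, ENNReal.tsum_eq_zero]
  intro v
  by_cases hv : degN G v = 0
  · simp [hv]
  · simp [h v hv]

lemma lintegral_paStep (n : ℕ) (G : SimpleGraph ℕ) (f : SimpleGraph ℕ → ℝ≥0∞) :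
    ∫⁻ H, f H ∂paStep n G =
      ∑' v, ((degN G v : ℝ≥0∞) / ((2 * (n - 1) : ℕ) : ℝ≥0∞)) * f (addEdge G n v) := by
  simp [paStep, lintegral_sum_measure, lintegral_smul_measure, lintegral_dirac]

lemma PAlaw_self (k : ℕ) (T : SimpleGraph ℕ) : PAlaw k T k = Measure.dirac T := by
  simp [PAlaw, PAlawAux]

lemma PAlaw_succ {k n : ℕ} (hn : k ≤ n) (T : SimpleGraph ℕ) :
    PAlaw k T (n + 1) = (PAlaw k T n).bind (paStep n) := by
  rw [PAlaw, PAlaw, Nat.succ_sub hn, PAlawAux, Nat.add_sub_cancel' hn]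

lemma ae_isTreeLike_PAlaw {k : ℕ} (hk : 0 < k) {T : SimpleGraph ℕ} (hT : IsTreeOn k T) {n : ℕ}
    (hn : k ≤ n) : ∀ᵐ G ∂PAlaw k T n, IsTreeLike n G := by
  induction n, hn using Nat.le_induction with
  | base => simpa [PAlaw_self, ae_dirac_eq] using hT.isTreeLike
  | succ n hn ih =>
    rw [PAlaw_succ hn]
    refine ae_bind_of_ae (ih.mono fun G hG => ae_paStep fun v hv => ?_)
    exact hG.addEdge (hk.trans_le hn) (hG.lt_of_degN_ne_zero hv)

lemma mul_multichoose_succ (d m : ℕ) :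
    d * Nat.multichoose (d + 1) m = (d + m) * Nat.multichoose d m := by
  rcases m with _ | m
  · simp
  · rcases d with _ | d
    · simp
    · rw [Nat.multichoose_eq, Nat.multichoose_eq,
        show d + 1 + 1 + (m + 1) - 1 = d + m + 1 + 1 by omega,
        show d + 1 + (m + 1) - 1 = d + m + 1 by omega]
      have h := Nat.choose_mul_succ_eq (d + m + 1) (m + 1)
      rw [show d + m + 1 + 1 - (m + 1) = d + 1 by omega] at h
      rw [mul_comm, ← h, mul_comm]
      ring

/-- The rising-factorial moments of the degree of `v` are multiplied by `1 + m / (2 (n - 1))` in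
one step of preferential attachment. -/
lemma lintegral_multichoose_paStep {n : ℕ} (hn : 2 ≤ n) {G : SimpleGraph ℕ} (hG : IsTreeLike n G)
    {v : ℕ} (hv : v < n) (m : ℕ) :
    ∫⁻ H, ((degN H v).multichoose m : ℝ≥0∞) ∂paStep n G =
      (1 + (m : ℝ≥0∞) / ((2 * (n - 1) : ℕ) : ℝ≥0∞)) * ((degN G v).multichoose m : ℝ≥0∞) := by
  set N : ℝ≥0∞ := ((2 * (n - 1) : ℕ) : ℝ≥0∞) with hN
  have hN0 : N ≠ 0 := by
    rw [hN, Nat.cast_ne_zero]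
    omega
  have hNtop : N ≠ ∞ := ENNReal.natCast_ne_top _
  have hterm : ∀ w, (degN G w : ℝ≥0∞) / N * ((degN (addEdge G n w) v).multichoose m : ℝ≥0∞) =
      (degN G w : ℝ≥0∞) / N * ((degN G v).multichoose m : ℝ≥0∞) +
        if w = v then (m : ℝ≥0∞) / N * ((degN G v).multichoose m : ℝ≥0∞) else 0 := by
    intro w
    by_cases hw : degN G w = 0
    · by_cases hwv : w = v
      · subst hwv
        rcases m with _ | m <;> simp [hw]
      · simp [hw, hwv]
    have hwn := hG.lt_of_degN_ne_zero hw
    rw [hG.degN_addEdge hwn, if_neg hv.ne, add_zero]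
    by_cases hwv : w = v
    · subst hwv
      have key : (degN G w : ℝ≥0∞) * ((degN G w + 1).multichoose m : ℝ≥0∞) =
          (degN G w + m) * ((degN G w).multichoose m : ℝ≥0∞) := by
        exact_mod_cast mul_multichoose_succ (degN G w) m
      simp only [if_true]
      rw [ENNReal.div_eq_inv_mul, mul_assoc, key, ENNReal.div_eq_inv_mul]
      ring
    · simp [hwv, Ne.symm hwv]
  have hsum : ∑' w, (degN G w : ℝ≥0∞) / N = 1 := by
    rw [tsum_eq_sum (s := Finset.range n)]
    · simp_rw [div_eq_mul_inv]
      rw [← Finset.sum_mul, ← Nat.cast_sum, hG.2]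
      exact ENNReal.mul_inv_cancel hN0 hNtop
    · intro w hw
      rw [hG.degN_eq_zero (by simpa using hw)]
      simp
  rw [lintegral_paStep, tsum_congr hterm, ENNReal.tsum_add, ENNReal.tsum_mul_right, hsum,
    tsum_ite_eq, add_mul]

lemma isProbabilityMeasure_PAlaw {k : ℕ} (hk : 2 ≤ k) {T : SimpleGraph ℕ} (hT : IsTreeOn k T)
    {n : ℕ} (hn : k ≤ n) : IsProbabilityMeasure (PAlaw k T n) := by
  induction n, hn using Nat.le_induction with
  | base =>
    rw [PAlaw_self]
    infer_instance
  | succ n hn ih =>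
    constructor
    rw [PAlaw_succ hn, Measure.bind_apply MeasurableSet.univ Measurable.of_discrete.aemeasurable]
    have h : ∀ᵐ G ∂PAlaw k T n, paStep n G Set.univ = 1 := by
      refine (ae_isTreeLike_PAlaw (by omega) hT hn).mono fun G hG => ?_
      have := lintegral_multichoose_paStep (hk.trans hn) hG (v := 0) (by omega) 0
      simpa using this
    rw [lintegral_congr_ae h]
    simp

/-- The normalised rising-factorial moments of the degree of a vertex outside of the seed. -/
def moment (v m M : ℕ) : ℝ := ∏ j ∈ Finset.range M, (1 + (m : ℝ) / (2 * (v + j)))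

lemma moment_nonneg (v m M : ℕ) : 0 ≤ moment v m M :=
  Finset.prod_nonneg fun _ _ => by positivity

lemma moment_succ (v m M : ℕ) :
    moment v m (M + 1) = moment v m M * (1 + (m : ℝ) / (2 * (v + M))) :=
  Finset.prod_range_succ _ _

lemma lintegral_multichoose_PAlaw {k : ℕ} (hk : 2 ≤ k) {T : SimpleGraph ℕ} (hT : IsTreeOn k T)
    {v : ℕ} (hv : k ≤ v) (m M : ℕ) :
    ∫⁻ G, ((degN G v).multichoose m : ℝ≥0∞) ∂PAlaw k T (v + 1 + M) =
      ENNReal.ofReal (moment v m M) := by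
  induction M with
  | zero =>
    have h : ∀ᵐ G ∂PAlaw k T (v + 1), ((degN G v).multichoose m : ℝ≥0∞) = 1 := by
      rw [PAlaw_succ hv]
      refine ae_bind_of_ae ((ae_isTreeLike_PAlaw (by omega) hT hv).mono fun G hG =>
        ae_paStep fun w hw => ?_)
      have hwv := hG.lt_of_degN_ne_zero hw
      rw [hG.degN_addEdge hwv, hG.degN_eq_zero le_rfl]
      simp [hwv.ne']
    have := isProbabilityMeasure_PAlaw hk hT (n := v + 1) (by omega)
    rw [add_zero, lintegral_congr_ae h]
    simp [moment]
  | succ M ih =>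
    have hn : k ≤ v + 1 + M := by omega
    rw [← add_assoc, PAlaw_succ hn, Measure.lintegral_bind Measurable.of_discrete.aemeasurable
      Measurable.of_discrete.aemeasurable]
    have h : ∀ᵐ G ∂PAlaw k T (v + 1 + M),
        ∫⁻ H, ((degN H v).multichoose m : ℝ≥0∞) ∂paStep (v + 1 + M) G =
          (1 + (m : ℝ≥0∞) / ((2 * (v + 1 + M - 1) : ℕ) : ℝ≥0∞)) *
            ((degN G v).multichoose m : ℝ≥0∞) :=
      (ae_isTreeLike_PAlaw (by omega) hT hn).mono fun G hG =>
        lintegral_multichoose_paStep (hk.trans hn) hG (by omega) m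
    rw [lintegral_congr_ae h, lintegral_const_mul _ Measurable.of_discrete, ih, moment_succ,
      mul_comm, ENNReal.ofReal_mul (moment_nonneg v m M)]
    congr 1
    have hpos : (0 : ℝ) < 2 * (v + M) := by
      have : (0 : ℝ) < v := by
        exact_mod_cast (by omega : 0 < v)
      positivity
    rw [ENNReal.ofReal_add zero_le_one (by positivity), ENNReal.ofReal_one,
      ENNReal.ofReal_div_of_pos hpos, ENNReal.ofReal_natCast]
    congr 2
    rw [show v + 1 + M - 1 = v + M by omega, ← ENNReal.ofReal_natCast]
    push_cast
    rfl

/-- The limit of the rescaled normalised moments. -/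
def limitMoment (v m : ℕ) : ℝ := Real.Gamma v / Real.Gamma (v + m / 2)

lemma tendsto_moment {v : ℕ} (hv : 0 < v) (m : ℕ) :
    Tendsto (fun M : ℕ => moment v m (M + 1) / √(M : ℝ) ^ m) atTop (nhds (limitMoment v m)) := by
  have hv' : (0 : ℝ) < v := by exact_mod_cast hv
  have hpos : (0 : ℝ) < v + m / 2 := by positivity
  refine ((Real.GammaSeq_tendsto_Gamma (v : ℝ)).div
    (Real.GammaSeq_tendsto_Gamma ((v : ℝ) + m / 2)) (Real.Gamma_pos_of_pos hpos).ne').congr' ?_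
  filter_upwards [eventually_gt_atTop 0] with M hM
  have hM' : (0 : ℝ) < M := by exact_mod_cast hM
  have hsqrt : √(M : ℝ) ^ m = (M : ℝ) ^ ((m : ℝ) / 2) := by
    rw [Real.sqrt_eq_rpow, ← Real.rpow_natCast, ← Real.rpow_mul hM'.le]
    congr 1
    ring
  have hprod : moment v m (M + 1) =
      (∏ j ∈ Finset.range (M + 1), ((v : ℝ) + m / 2 + j)) /
        ∏ j ∈ Finset.range (M + 1), ((v : ℝ) + j) := by
    rw [moment, ← Finset.prod_div_distrib]
    refine Finset.prod_congr rfl fun j _ => ?_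
    have : (0 : ℝ) < v + j := by positivity
    field_simp
    ring
  have h1 : (∏ j ∈ Finset.range (M + 1), ((v : ℝ) + j)) ≠ 0 :=
    Finset.prod_ne_zero_iff.2 fun j _ => by positivity
  have h2 : (∏ j ∈ Finset.range (M + 1), ((v : ℝ) + m / 2 + j)) ≠ 0 :=
    Finset.prod_ne_zero_iff.2 fun j _ => by positivity
  have h3 : (M : ℝ) ^ (v : ℝ) ≠ 0 := (Real.rpow_pos_of_pos hM' _).ne'
  have h4 : (M : ℝ) ^ ((m : ℝ) / 2) ≠ 0 := (Real.rpow_pos_of_pos hM' _).ne'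
  have h5 : ((M.factorial : ℕ) : ℝ) ≠ 0 := by positivity
  simp only [Pi.div_apply]
  rw [Real.GammaSeq, Real.GammaSeq, hprod, hsqrt, Real.rpow_add hM']
  field_simp

lemma moment_div_succ_le {v : ℕ} (m : ℕ) {M : ℕ} (hM : 1 ≤ M) :
    moment v m (M + 1 + 1) / √((M + 1 : ℕ) : ℝ) ^ m ≤ moment v m (M + 1) / √(M : ℝ) ^ m := by
  have hM' : (1 : ℝ) ≤ M := by exact_mod_cast hM
  have hv : (0 : ℝ) ≤ v := by positivity
  have hs : 0 < √(M : ℝ) := Real.sqrt_pos.2 (by linarith)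
  have hs' : 0 < √((M + 1 : ℕ) : ℝ) := Real.sqrt_pos.2 (by positivity)
  set a : ℝ := 1 / (2 * (v + (M + 1 : ℕ))) with ha
  have ha0 : 0 ≤ a := by positivity
  have hfac : 1 + (m : ℝ) / (2 * (v + (M + 1 : ℕ))) ≤ (1 + a) ^ m := by
    have := one_add_mul_le_pow (a := a) (by linarith) m
    rw [ha] at this ⊢
    rwa [mul_one_div] at this
  have ha1 : a ≤ 1 / (2 * (M + 1)) := by
    rw [ha]
    push_cast
    exact one_div_le_one_div_of_le (by positivity) (by linarith)
  have hroot : (1 + a) * √(M : ℝ) ≤ √((M + 1 : ℕ) : ℝ) := by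
    refine Real.le_sqrt_of_sq_le ?_
    rw [mul_pow, Real.sq_sqrt (by linarith)]
    push_cast
    have : (1 + a) ^ 2 ≤ (1 + 1 / (2 * ((M : ℝ) + 1))) ^ 2 := by gcongr
    refine (mul_le_mul_of_nonneg_right this (by linarith)).trans ?_
    rw [← sub_nonneg]
    have h : (M : ℝ) + 1 - (1 + 1 / (2 * ((M : ℝ) + 1))) ^ 2 * M =
      (3 * M + 4) / (4 * ((M : ℝ) + 1) ^ 2) := by
      field_simp
      ring
    rw [h]
    positivity
  rw [moment_succ, div_le_div_iff₀ (by positivity) (by positivity), mul_assoc]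
  refine mul_le_mul_of_nonneg_left ?_ (moment_nonneg _ _ _)
  calc _ ≤ (1 + a) ^ m * √(M : ℝ) ^ m := by gcongr
    _ = ((1 + a) * √(M : ℝ)) ^ m := (mul_pow _ _ _).symm
    _ ≤ _ := by gcongr

lemma moment_div_antitone {v : ℕ} (m : ℕ) {M M' : ℕ} (hM : 1 ≤ M) (h : M ≤ M') :
    moment v m (M' + 1) / √(M' : ℝ) ^ m ≤ moment v m (M + 1) / √(M : ℝ) ^ m := by
  induction M', h using Nat.le_induction with
  | base => rfl
  | succ M' h ih => exact (moment_div_succ_le m (hM.trans h)).trans ih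

lemma limitMoment_nonneg (v m : ℕ) : 0 ≤ limitMoment v m :=
  div_nonneg (Real.Gamma_nonneg_of_nonneg (by positivity))
    (Real.Gamma_nonneg_of_nonneg (by positivity))

lemma limitMoment_le {v : ℕ} (hv : 0 < v) (m : ℕ) {M : ℕ} (hM : 1 ≤ M) :
    limitMoment v m ≤ moment v m (M + 1) / √(M : ℝ) ^ m :=
  le_of_tendsto (tendsto_moment hv m)
    ((eventually_ge_atTop M).mono fun _ h => moment_div_antitone m hM h)

lemma summable_pow_mul_moment {v : ℕ} (hv : 0 < v) (M : ℕ) {x : ℝ} (hx0 : 0 ≤ x) (hx1 : x < 1) :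
    Summable fun m : ℕ => x ^ m * moment v m M := by
  rcases hx0.eq_or_lt with rfl | hx0
  · refine summable_of_ne_finset_zero (s := {0}) fun m hm => ?_
    simp at hm
    simp [hm]
  have h1 : Summable fun m : ℕ => ((m + 1 : ℕ) : ℝ) ^ M * x ^ (m + 1) :=
    (summable_nat_add_iff 1).2
      (summable_pow_mul_geometric_of_norm_lt_one (R := ℝ) M
        (by rwa [Real.norm_eq_abs, abs_of_pos hx0]))
  refine Summable.of_nonneg_of_le (fun m => mul_nonneg (by positivity) (moment_nonneg _ _ _))
    (fun m => ?_) (h1.mul_right x⁻¹)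
  have hle : moment v m M ≤ ((m + 1 : ℕ) : ℝ) ^ M := by
    rw [moment, ← Finset.card_range M, ← Finset.prod_const, Finset.card_range]
    refine Finset.prod_le_prod (fun j _ => by positivity) fun j _ => ?_
    have hv' : (1 : ℝ) ≤ v := by exact_mod_cast hv
    have : (m : ℝ) / (2 * (v + j)) ≤ m :=
      div_le_self (by positivity) (by nlinarith [(Nat.cast_nonneg j : (0 : ℝ) ≤ j)])
    push_cast
    linarith
  have : ((m + 1 : ℕ) : ℝ) ^ M * x ^ (m + 1) * x⁻¹ = x ^ m * ((m + 1 : ℕ) : ℝ) ^ M := by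
    field_simp
    ring
  rw [this]
  gcongr

lemma summable_pow_mul_moment_div {v : ℕ} (hv : 0 < v) {M : ℕ} {s : ℝ} (hs : 0 ≤ s)
    (hM : s < √(M : ℝ)) : Summable fun m : ℕ => s ^ m * (moment v m (M + 1) / √(M : ℝ) ^ m) := by
  have hpos : 0 < √(M : ℝ) := hs.trans_lt hM
  refine (summable_pow_mul_moment hv (M + 1) (x := s / √(M : ℝ)) (by positivity)
    ((div_lt_one hpos).2 hM)).congr fun m => ?_
  rw [div_pow]
  ring

lemma eventually_lt_sqrt (s : ℝ) : ∀ᶠ M : ℕ in atTop, s < √(M : ℝ) :=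
  (Real.tendsto_sqrt_atTop.comp tendsto_natCast_atTop_atTop).eventually_gt_atTop s

lemma summable_pow_mul_limitMoment {v : ℕ} (hv : 0 < v) {s : ℝ} (hs : 0 ≤ s) :
    Summable fun m : ℕ => s ^ m * limitMoment v m := by
  obtain ⟨M, hM, hM1⟩ := ((eventually_lt_sqrt s).and (eventually_ge_atTop 1)).exists
  refine Summable.of_nonneg_of_le
    (fun m => mul_nonneg (by positivity) (limitMoment_nonneg _ _)) (fun m => ?_)
    (summable_pow_mul_moment_div hv hs hM)
  gcongr
  exact limitMoment_le hv m hM1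

lemma tendsto_tsum_moment {v : ℕ} (hv : 0 < v) (z : ℂ) :
    Tendsto (fun M : ℕ => ∑' m : ℕ, (z / (√(M : ℝ) : ℝ)) ^ m * (moment v m (M + 1) : ℂ)) atTop
      (nhds (∑' m : ℕ, z ^ m * (limitMoment v m : ℂ))) := by
  obtain ⟨M₀, hM, hM1⟩ := ((eventually_lt_sqrt ‖z‖).and (eventually_ge_atTop 1)).exists
  have heq : ∀ M m : ℕ, (z / (√(M : ℝ) : ℝ)) ^ m * (moment v m (M + 1) : ℂ) =
      z ^ m * ((moment v m (M + 1) / √(M : ℝ) ^ m : ℝ) : ℂ) := by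
    intro M m
    push_cast
    rw [div_pow]
    ring
  simp_rw [heq]
  refine tendsto_tsum_of_dominated_convergence
    (summable_pow_mul_moment_div hv (norm_nonneg z) hM) (fun m => ?_) ?_
  · exact (Complex.continuous_ofReal.tendsto _ |>.comp (tendsto_moment hv m)).const_mul _
  · filter_upwards [eventually_ge_atTop M₀] with M hMM m
    rw [norm_mul, norm_pow, Complex.norm_real, Real.norm_of_nonneg
      (div_nonneg (moment_nonneg _ _ _) (by positivity))]
    exact mul_le_mul_of_nonneg_left (moment_div_antitone m hM1 hMM) (by positivity)

lemma hasSum_multichoose_mul_pow (d : ℕ) {x : ℂ} (hx : ‖x‖ < 1) :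
    HasSum (fun m : ℕ => x ^ m * (d.multichoose m : ℂ)) ((1 - x) ^ d)⁻¹ := by
  rcases d with _ | d
  · convert hasSum_ite_eq (0 : ℕ) (1 : ℂ) using 1
    · ext m
      rcases m with _ | m <;> simp
    · simp
  · have h := hasSum_choose_mul_geometric_of_norm_lt_one d hx
    rw [one_div] at h
    refine h.congr_fun fun m => ?_
    rw [Nat.multichoose_eq, show d + 1 + m - 1 = m + d by omega, mul_comm,
      Nat.choose_symm_add]

lemma integrable_multichoose_PAlaw {k : ℕ} (hk : 2 ≤ k) {T : SimpleGraph ℕ} (hT : IsTreeOn k T)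
    {v : ℕ} (hv : k ≤ v) (m M : ℕ) :
    Integrable (fun G => ((degN G v).multichoose m : ℝ)) (PAlaw k T (v + 1 + M)) := by
  refine ⟨Measurable.of_discrete.aestronglyMeasurable, ?_⟩
  rw [hasFiniteIntegral_iff_ofReal (Eventually.of_forall fun _ => Nat.cast_nonneg _)]
  simp_rw [ENNReal.ofReal_natCast]
  rw [lintegral_multichoose_PAlaw hk hT hv]
  exact ENNReal.ofReal_lt_top

lemma integral_multichoose_PAlaw {k : ℕ} (hk : 2 ≤ k) {T : SimpleGraph ℕ} (hT : IsTreeOn k T)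
    {v : ℕ} (hv : k ≤ v) (m M : ℕ) :
    ∫ G, ((degN G v).multichoose m : ℝ) ∂PAlaw k T (v + 1 + M) = moment v m M := by
  rw [integral_eq_lintegral_of_nonneg_ae (Eventually.of_forall fun _ => Nat.cast_nonneg _)
    Measurable.of_discrete.aestronglyMeasurable]
  simp_rw [ENNReal.ofReal_natCast]
  rw [lintegral_multichoose_PAlaw hk hT hv, ENNReal.toReal_ofReal (moment_nonneg _ _ _)]

lemma integral_inv_pow_PAlaw {k : ℕ} (hk : 2 ≤ k) {T : SimpleGraph ℕ} (hT : IsTreeOn k T)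
    {v : ℕ} (hv : k ≤ v) (M : ℕ) {x : ℂ} (hx : ‖x‖ < 1) :
    ∫ G, ((1 - x) ^ degN G v)⁻¹ ∂PAlaw k T (v + 1 + M) =
      ∑' m : ℕ, x ^ m * (moment v m M : ℂ) := by
  have hint : ∀ m, Integrable (fun G => ((degN G v).multichoose m : ℂ))
      (PAlaw k T (v + 1 + M)) := fun m => by
    simpa using (integrable_multichoose_PAlaw hk hT hv m M).ofReal (𝕜 := ℂ)
  have h := hasSum_integral_of_summable_integral_norm (μ := PAlaw k T (v + 1 + M))
    (F := fun (m : ℕ) (G : SimpleGraph ℕ) => x ^ m * ((degN G v).multichoose m : ℂ))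
    (fun m => (hint m).const_mul _) ?_
  · rw [integral_congr_ae (g := fun G => ∑' m : ℕ, x ^ m * ((degN G v).multichoose m : ℂ))
      (Eventually.of_forall fun G => (hasSum_multichoose_mul_pow _ hx).tsum_eq.symm),
      ← h.tsum_eq]
    refine tsum_congr fun m => ?_
    rw [integral_const_mul, ← integral_multichoose_PAlaw hk hT hv m M, ← integral_complex_ofReal]
    simp
  · refine (summable_pow_mul_moment (v := v) (by omega) M (norm_nonneg x) hx).congr fun m => ?_
    rw [← integral_multichoose_PAlaw hk hT hv m M, ← integral_const_mul]
    simp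

lemma norm_inv_one_sub_pow_le (s r : ℝ) (d : ℕ) :
    ‖((1 - (s * Complex.I : ℂ) / (r : ℂ)) ^ d)⁻¹‖ ≤ 1 := by
  rw [norm_inv, norm_pow]
  refine inv_le_one_of_one_le₀ (one_le_pow₀ ?_)
  refine le_trans ?_ (Complex.re_le_norm _)
  simp [Complex.div_re]

lemma tendsto_inv_one_sub_pow (s D : ℝ) {d : ℕ → ℕ}
    (hd : Tendsto (fun M : ℕ => (d M : ℝ) / √(M : ℝ)) atTop (nhds D)) :
    Tendsto (fun M : ℕ => ((1 - (s * Complex.I : ℂ) / ((√(M : ℝ) : ℝ) : ℂ)) ^ d M)⁻¹) atTop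
      (nhds (Complex.exp (s * D * Complex.I))) := by
  have hroot : Tendsto (fun M : ℕ => √(M : ℝ)) atTop atTop :=
    Real.tendsto_sqrt_atTop.comp tendsto_natCast_atTop_atTop
  have h1 : Tendsto (fun x : ℝ => (x : ℂ) * Complex.log (1 + -(s * Complex.I) / (x : ℂ))) atTop
      (nhds (-(s * Complex.I))) := by
    refine Complex.tendsto_mul_log_one_add_of_tendsto (tendsto_const_nhds.congr' ?_)
    filter_upwards [eventually_gt_atTop 0] with x hx
    have : (x : ℂ) ≠ 0 := by exact_mod_cast hx.ne'
    field_simp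
  have h2 := ((Complex.continuous_ofReal.tendsto _).comp hd).mul (h1.comp hroot)
  have h3 := ((Complex.continuous_exp.tendsto _).comp h2).inv₀ (Complex.exp_ne_zero _)
  rw [← Complex.exp_neg, show -((D : ℂ) * -(s * Complex.I)) = s * D * Complex.I by ring] at h3
  refine h3.congr' ?_
  filter_upwards [eventually_gt_atTop 0] with M hM
  have hr : ((√(M : ℝ) : ℝ) : ℂ) ≠ 0 := by
    exact_mod_cast (Real.sqrt_pos.2 (by exact_mod_cast hM)).ne'
  have hne : (1 : ℂ) + -(s * Complex.I) / ((√(M : ℝ) : ℝ) : ℂ) ≠ 0 := by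
    intro h
    have := congrArg Complex.re h
    simp [Complex.div_re] at this
  simp only [Function.comp_apply]
  rw [show (((d M : ℝ) / √(M : ℝ) : ℝ) : ℂ) * (((√(M : ℝ) : ℝ) : ℂ) *
      Complex.log (1 + -(s * Complex.I) / ((√(M : ℝ) : ℝ) : ℂ))) =
      d M * Complex.log (1 + -(s * Complex.I) / ((√(M : ℝ) : ℝ) : ℂ)) by
    push_cast
    field_simp, Complex.exp_nat_mul, Complex.exp_log hne, neg_div, ← sub_eq_add_neg]

lemma tendsto_sqrt_add_div_sqrt (c : ℕ) :
    Tendsto (fun M : ℕ => √((c + (M + 1) : ℕ) : ℝ) / √(M : ℝ)) atTop (nhds 1) := by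
  have h : Tendsto (fun M : ℕ => ((c : ℝ) + 1) / (M : ℝ) + 1) atTop (nhds (0 + 1)) :=
    (tendsto_const_div_atTop_nhds_zero_nat _).add_const 1
  have h2 := h.sqrt
  rw [zero_add, Real.sqrt_one] at h2
  refine h2.congr' ?_
  filter_upwards [eventually_gt_atTop 0] with M hM
  have hM' : (0 : ℝ) < M := by exact_mod_cast hM
  rw [← Real.sqrt_div (by positivity)]
  congr 1
  push_cast
  field_simp
  ring

section LimitLaw

variable {k : ℕ} {T : SimpleGraph ℕ} {Ω : Type} [MeasurableSpace Ω] {P : Measure Ω}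
  {X : ℕ → Ω → SimpleGraph ℕ} {D : Ω → ℝ} {v : ℕ}

lemma aemeasurable_graph (hk : 2 ≤ k) (hT : IsTreeOn k T)
    (hX : ∀ n : ℕ, k ≤ n → P.map (X n) = PAlaw k T n) {n : ℕ} (hn : k ≤ n) :
    AEMeasurable (X n) P := by
  have := isProbabilityMeasure_PAlaw hk hT hn
  refine aemeasurable_of_map_neZero ?_
  rw [hX n hn]
  infer_instance

lemma tendsto_degN_div_sqrt
    (hD : ∀ᵐ ω ∂P, Tendsto (fun n : ℕ => (degN (X n ω) v : ℝ) / √(n : ℝ)) atTop (nhds (D ω))) :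
    ∀ᵐ ω ∂P, Tendsto (fun M : ℕ => (degN (X (v + 1 + (M + 1)) ω) v : ℝ) / √(M : ℝ)) atTop
      (nhds (D ω)) := by
  filter_upwards [hD] with ω hω
  have hshift : Tendsto (fun M : ℕ => v + 1 + (M + 1)) atTop atTop :=
    tendsto_atTop_mono (fun M => show M ≤ v + 1 + (M + 1) by omega) tendsto_id
  have h := (hω.comp hshift).mul (tendsto_sqrt_add_div_sqrt (v + 1))
  rw [mul_one] at h
  refine h.congr fun M => ?_
  have : √((v + 1 + (M + 1) : ℕ) : ℝ) ≠ 0 := (Real.sqrt_pos.2 (by positivity)).ne'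
  simp only [Function.comp_apply]
  field_simp

lemma aemeasurable_limit (hk : 2 ≤ k) (hT : IsTreeOn k T)
    (hX : ∀ n : ℕ, k ≤ n → P.map (X n) = PAlaw k T n) (hv : k ≤ v)
    (hD : ∀ᵐ ω ∂P, Tendsto (fun n : ℕ => (degN (X n ω) v : ℝ) / √(n : ℝ)) atTop (nhds (D ω))) :
    AEMeasurable D P := by
  refine aemeasurable_of_tendsto_metrizable_ae' (fun M => ?_) (tendsto_degN_div_sqrt hD)
  have h : Measurable fun G : SimpleGraph ℕ => (degN G v : ℝ) / √(M : ℝ) := Measurable.of_discrete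
  exact h.comp_aemeasurable (aemeasurable_graph hk hT hX (by omega))

/-- The characteristic function of the limiting degree of a vertex outside of the seed. -/
lemma charFun_limit [IsProbabilityMeasure P] (hk : 2 ≤ k) (hT : IsTreeOn k T)
    (hX : ∀ n : ℕ, k ≤ n → P.map (X n) = PAlaw k T n) (hv : k ≤ v)
    (hD : ∀ᵐ ω ∂P, Tendsto (fun n : ℕ => (degN (X n ω) v : ℝ) / √(n : ℝ)) atTop (nhds (D ω)))
    (s : ℝ) :
    charFun (P.map D) s = ∑' m : ℕ, (s * Complex.I : ℂ) ^ m * (limitMoment v m : ℂ) := by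
  rw [charFun_apply_real, integral_map (aemeasurable_limit hk hT hX hv hD)
    (by fun_prop)]
  refine tendsto_nhds_unique ?_ (tendsto_tsum_moment (v := v) (by omega) (s * Complex.I))
  have hlim : Tendsto (fun M : ℕ => ∫ ω, ((1 - (s * Complex.I : ℂ) / ((√(M : ℝ) : ℝ) : ℂ)) ^
      degN (X (v + 1 + (M + 1)) ω) v)⁻¹ ∂P) atTop
      (nhds (∫ ω, Complex.exp (s * D ω * Complex.I) ∂P)) := by
    refine tendsto_integral_of_dominated_convergence (fun _ => 1) (fun M => ?_)
      (integrable_const _) (fun M => Eventually.of_forall fun ω => norm_inv_one_sub_pow_le _ _ _) ?_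
    · have h : Measurable fun G : SimpleGraph ℕ =>
          ((1 - (s * Complex.I : ℂ) / ((√(M : ℝ) : ℝ) : ℂ)) ^ degN G v)⁻¹ := Measurable.of_discrete
      exact (h.comp_aemeasurable (aemeasurable_graph hk hT hX (by omega))).aestronglyMeasurable
    · filter_upwards [tendsto_degN_div_sqrt hD] with ω hω
      exact tendsto_inv_one_sub_pow s (D ω) hω
  refine hlim.congr' ?_
  filter_upwards [eventually_lt_sqrt |s|] with M hM
  have hpos : 0 < √(M : ℝ) := (abs_nonneg s).trans_lt hM
  rw [← integral_inv_pow_PAlaw hk hT hv (M + 1), ← hX _ (by omega),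
    integral_map (aemeasurable_graph hk hT hX (by omega))
      Measurable.of_discrete.aestronglyMeasurable]
  rw [norm_div, norm_mul, Complex.norm_I, mul_one, Complex.norm_real, Complex.norm_real,
    Real.norm_of_nonneg hpos.le, Real.norm_eq_abs, div_lt_one hpos]
  exact hM

end LimitLaw

lemma charFun_map_eq_tsum_of_moments {α : Type*} [MeasurableSpace α] {ρ : Measure α} {Y : α → ℝ}
    (hY : Measurable Y) (hY0 : ∀ a, 0 ≤ Y a) {c : ℕ → ℝ} (hc : ∀ m, 0 ≤ c m)
    (hmom : ∀ m : ℕ, ∫⁻ a, ENNReal.ofReal (Y a ^ m) ∂ρ = ENNReal.ofReal (m.factorial * c m))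
    {s : ℝ} (hs : Summable fun m : ℕ => |s| ^ m * c m) :
    charFun (ρ.map Y) s = ∑' m : ℕ, (s * Complex.I : ℂ) ^ m * (c m : ℂ) := by
  rw [charFun_apply_real, integral_map hY.aemeasurable (by fun_prop)]
  have hint : ∀ m, Integrable (fun a => Y a ^ m) ρ := fun m => by
    refine ⟨(hY.pow_const m).aestronglyMeasurable, ?_⟩
    rw [hasFiniteIntegral_iff_ofReal (Eventually.of_forall fun a => pow_nonneg (hY0 a) m), hmom]
    exact ENNReal.ofReal_lt_top
  have hval : ∀ m, ∫ a, Y a ^ m ∂ρ = m.factorial * c m := fun m => by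
    rw [integral_eq_lintegral_of_nonneg_ae (Eventually.of_forall fun a => pow_nonneg (hY0 a) m)
      (hY.pow_const m).aestronglyMeasurable, hmom,
      ENNReal.toReal_ofReal (mul_nonneg (Nat.cast_nonneg _) (hc m))]
  have hfac : ∀ m : ℕ, (m.factorial : ℝ) ≠ 0 := fun m => by positivity
  have h := hasSum_integral_of_summable_integral_norm (μ := ρ)
    (F := fun (m : ℕ) (a : α) => (s * Complex.I : ℂ) ^ m / m.factorial * ((Y a ^ m : ℝ) : ℂ))
    (fun m => (hint m).ofReal.const_mul _) ?_
  · rw [integral_congr_ae (g := fun a => ∑' m : ℕ,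
      (s * Complex.I : ℂ) ^ m / m.factorial * ((Y a ^ m : ℝ) : ℂ)), ← h.tsum_eq]
    · refine tsum_congr fun m => ?_
      rw [integral_const_mul, integral_complex_ofReal, hval]
      have : (m.factorial : ℂ) ≠ 0 := by exact_mod_cast hfac m
      push_cast
      field_simp
    · refine Eventually.of_forall fun a => ?_
      have hexp := NormedSpace.expSeries_div_hasSum_exp (𝔸 := ℂ) (s * Y a * Complex.I)
      rw [← Complex.exp_eq_exp_ℂ] at hexp
      simp only
      rw [← hexp.tsum_eq]
      refine tsum_congr fun m => ?_
      push_cast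
      ring
  · refine hs.congr fun m => ?_
    have hn : ∀ a, ‖(s * Complex.I : ℂ) ^ m / m.factorial * ((Y a ^ m : ℝ) : ℂ)‖ =
        |s| ^ m / m.factorial * Y a ^ m := fun a => by
      rw [norm_mul, norm_div, norm_pow, norm_mul, Complex.norm_I, Complex.norm_real,
        Complex.norm_real, Complex.norm_natCast, Real.norm_of_nonneg (pow_nonneg (hY0 a) m),
        Real.norm_eq_abs, mul_one]
    simp_rw [hn]
    rw [integral_const_mul, hval]
    have := hfac m
    field_simp

/-- The law of the absolute value of a centred normal variable of variance `2`. -/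
def halfNormal : Measure ℝ :=
  (volume.restrict (Set.Ioi 0)).withDensity fun x =>
    ENNReal.ofReal (Real.exp (-x ^ 2 / 4) / √Real.pi)

lemma lintegral_halfNormal {f : ℝ → ℝ≥0∞} (hf : Measurable f) :
    ∫⁻ x, f x ∂halfNormal =
      ∫⁻ x in Set.Ioi 0, ENNReal.ofReal (Real.exp (-x ^ 2 / 4) / √Real.pi) * f x :=
  lintegral_withDensity_eq_lintegral_mul _ (by fun_prop) hf

instance : SFinite halfNormal := by
  unfold halfNormal
  infer_instance

lemma lintegral_abs_pow_halfNormal (m : ℕ) :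
    ∫⁻ x, ENNReal.ofReal (|x| ^ m) ∂halfNormal =
      ENNReal.ofReal (m.factorial / Real.Gamma (1 + m / 2)) := by
  rw [lintegral_halfNormal (by fun_prop)]
  have hm : (-1 : ℝ) < m := by
    have : (0 : ℝ) ≤ m := Nat.cast_nonneg m
    linarith
  have heq : ∀ x ∈ Set.Ioi (0 : ℝ),
      ENNReal.ofReal (Real.exp (-x ^ 2 / 4) / √Real.pi) * ENNReal.ofReal (|x| ^ m) =
        ENNReal.ofReal ((√Real.pi)⁻¹ * (x ^ (m : ℝ) * Real.exp (-(1 / 4) * x ^ (2 : ℝ)))) := by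
    intro x hx
    rw [← ENNReal.ofReal_mul (by positivity), abs_of_pos hx, Real.rpow_natCast, Real.rpow_two]
    congr 1
    rw [show -(1 / 4) * x ^ 2 = -x ^ 2 / 4 by ring]
    ring
  rw [setLIntegral_congr_fun measurableSet_Ioi heq, ← ofReal_integral_eq_lintegral_ofReal]
  · rw [integral_const_mul, integral_rpow_mul_exp_neg_mul_rpow two_pos hm (by norm_num)]
    congr 1
    have hdup := Real.Gamma_mul_Gamma_add_half (((m : ℝ) + 1) / 2)
    rw [show ((m : ℝ) + 1) / 2 + 1 / 2 = 1 + m / 2 by ring,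
      show 2 * (((m : ℝ) + 1) / 2) = m + 1 by ring, Real.Gamma_nat_eq_factorial] at hdup
    have hG : Real.Gamma (1 + (m : ℝ) / 2) ≠ 0 := (Real.Gamma_pos_of_pos (by positivity)).ne'
    have hpi : √Real.pi ≠ 0 := (Real.sqrt_pos.2 Real.pi_pos).ne'
    have hpow : ((1 : ℝ) / 4) ^ (-((m : ℝ) + 1) / 2) = 2 ^ ((m : ℝ) + 1) := by
      rw [show (1 : ℝ) / 4 = 2 ^ (-2 : ℝ) by norm_num [Real.rpow_neg], ← Real.rpow_mul two_pos.le]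
      congr 1
      ring
    have hcancel : (2 : ℝ) ^ ((m : ℝ) + 1) * 2 ^ (1 - ((m : ℝ) + 1)) = 2 := by
      rw [← Real.rpow_add two_pos]
      norm_num
    rw [hpow, eq_div_iff hG]
    calc _ = (√Real.pi)⁻¹ * 2 ^ ((m : ℝ) + 1) * (1 / 2) *
          (Real.Gamma (((m : ℝ) + 1) / 2) * Real.Gamma (1 + (m : ℝ) / 2)) := by ring
      _ = (m.factorial : ℝ) * ((2 : ℝ) ^ ((m : ℝ) + 1) * 2 ^ (1 - ((m : ℝ) + 1))) * (1 / 2) *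
          ((√Real.pi)⁻¹ * √Real.pi) := by
        rw [hdup]
        ring
      _ = _ := by
        rw [hcancel, inv_mul_cancel₀ hpi]
        ring
  · have := (integrableOn_rpow_mul_exp_neg_mul_sq (b := 1 / 4) (by norm_num) hm).const_mul
      (√Real.pi)⁻¹
    simpa only [Real.rpow_two, IntegrableOn] using this
  · refine ae_restrict_of_forall_mem measurableSet_Ioi fun x hx => ?_
    have : (0 : ℝ) < x := hx
    simp only [Pi.zero_apply]
    positivity

lemma lintegral_betaMeasure {a b : ℝ} {f : ℝ → ℝ≥0∞} (hf : Measurable f) :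
    ∫⁻ x, f x ∂ProbabilityTheory.betaMeasure a b =
      ∫⁻ x, ProbabilityTheory.betaPDF a b x * f x :=
  lintegral_withDensity_eq_lintegral_mul _
    (ProbabilityTheory.measurable_betaPDFReal a b).ennreal_ofReal hf

lemma lintegral_sqrt_pow_betaMeasure {b : ℝ} (hb : 0 < b) (m : ℕ) :
    ∫⁻ x, ENNReal.ofReal (√x ^ m) ∂ProbabilityTheory.betaMeasure 1 b =
      ENNReal.ofReal (Real.Gamma (1 + m / 2) * Real.Gamma (1 + b) /
        Real.Gamma (1 + m / 2 + b)) := by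
  have hm : (0 : ℝ) < 1 + m / 2 := by positivity
  have hB1 := ProbabilityTheory.beta_pos one_pos hb
  have hBm := ProbabilityTheory.beta_pos hm hb
  have hterm : ∀ x : ℝ, ProbabilityTheory.betaPDF 1 b x * ENNReal.ofReal (√x ^ m) =
      ENNReal.ofReal (ProbabilityTheory.beta (1 + m / 2) b / ProbabilityTheory.beta 1 b) *
        ProbabilityTheory.betaPDF (1 + m / 2) b x := by
    intro x
    rcases le_or_gt x 0 with hx0 | hx0
    · simp [ProbabilityTheory.betaPDF_eq_zero_of_nonpos hx0]
    rcases le_or_gt 1 x with hx1 | hx1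
    · simp [ProbabilityTheory.betaPDF_eq_zero_of_one_le hx1]
    have h1x : 0 < 1 - x := by linarith
    have hsqrt : √x ^ m = x ^ ((m : ℝ) / 2) := by
      rw [Real.sqrt_eq_rpow, ← Real.rpow_natCast, ← Real.rpow_mul hx0.le]
      congr 1
      ring
    rw [ProbabilityTheory.betaPDF_of_pos_lt_one hx0 hx1,
      ProbabilityTheory.betaPDF_of_pos_lt_one hx0 hx1, ← ENNReal.ofReal_mul (by positivity),
      ← ENNReal.ofReal_mul (by positivity), hsqrt]
    congr 1
    rw [sub_self, Real.rpow_zero, show 1 + (m : ℝ) / 2 - 1 = m / 2 by ring]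
    generalize ProbabilityTheory.beta (1 + m / 2) b = A at hBm ⊢
    have := hBm.ne'
    field_simp
  rw [lintegral_betaMeasure (by fun_prop), lintegral_congr hterm,
    lintegral_const_mul (f := ProbabilityTheory.betaPDF (1 + m / 2) b) _
      (ProbabilityTheory.measurable_betaPDFReal _ _).ennreal_ofReal,
    ProbabilityTheory.lintegral_betaPDF_eq_one hm hb, mul_one]
  congr 1
  have hGb : Real.Gamma b ≠ 0 := (Real.Gamma_pos_of_pos hb).ne'
  have hG1b : Real.Gamma (1 + b) ≠ 0 := (Real.Gamma_pos_of_pos (by positivity)).ne'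
  rw [ProbabilityTheory.beta, ProbabilityTheory.beta, Real.Gamma_one]
  field_simp

lemma betaMeasure_one_Ioi_le (p : ℕ) {s : ℝ} (hs0 : 0 ≤ s) (hs1 : s ≤ 1) :
    ProbabilityTheory.betaMeasure 1 ((p + 1 : ℕ) : ℝ) (Set.Ioi s) ≤
      ENNReal.ofReal ((1 - s) ^ (p + 1)) := by
  have hp : (0 : ℝ) < ((p + 1 : ℕ) : ℝ) := by positivity
  have hbeta : 1 / ProbabilityTheory.beta 1 ((p + 1 : ℕ) : ℝ) = ((p + 1 : ℕ) : ℝ) := by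
    have hG : Real.Gamma ((p + 1 : ℕ) : ℝ) ≠ 0 := (Real.Gamma_pos_of_pos hp).ne'
    rw [ProbabilityTheory.beta, Real.Gamma_one, add_comm (1 : ℝ), Real.Gamma_add_one hp.ne']
    field_simp
  have hpdf : ∀ x ∈ Set.Ioi s, ProbabilityTheory.betaPDF 1 ((p + 1 : ℕ) : ℝ) x ≤
      (Set.Ioc s 1).indicator
        (fun x => ENNReal.ofReal (((p + 1 : ℕ) : ℝ) * (1 - x) ^ p)) x := by
    intro x hx
    rcases le_or_gt 1 x with hx1 | hx1
    · simp [ProbabilityTheory.betaPDF_eq_zero_of_one_le hx1]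
    · rw [Set.indicator_of_mem (show x ∈ Set.Ioc s 1 from ⟨hx, hx1.le⟩),
        ProbabilityTheory.betaPDF_of_pos_lt_one (hs0.trans_lt hx) hx1, hbeta, sub_self,
        Real.rpow_zero, mul_one, show ((p + 1 : ℕ) : ℝ) - 1 = (p : ℝ) by push_cast; ring,
        Real.rpow_natCast]
  have hint : ∫ x in s..1, ((p + 1 : ℕ) : ℝ) * (1 - x) ^ p = (1 - s) ^ (p + 1) := by
    have hderiv : ∀ x ∈ Set.uIcc s 1, HasDerivAt (fun x : ℝ => -(1 - x) ^ (p + 1))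
        (((p + 1 : ℕ) : ℝ) * (1 - x) ^ p) x := by
      intro x _
      exact (((hasDerivAt_id x).const_sub 1).pow (p + 1)).neg.congr_deriv (by simp)
    rw [intervalIntegral.integral_eq_sub_of_hasDerivAt hderiv
      (Continuous.intervalIntegrable (by fun_prop) _ _)]
    simp
  rw [ProbabilityTheory.betaMeasure, withDensity_apply _ measurableSet_Ioi]
  refine (setLIntegral_mono' measurableSet_Ioi hpdf).trans ?_
  refine (setLIntegral_le_lintegral _ _).trans ?_
  rw [lintegral_indicator measurableSet_Ioc, ← ofReal_integral_eq_lintegral_ofReal,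
    ← intervalIntegral.integral_of_le hs1, hint]
  · exact (Continuous.integrableOn_Icc (by fun_prop)).mono_set Set.Ioc_subset_Icc_self
  · refine ae_restrict_of_forall_mem measurableSet_Ioc fun x hx => ?_
    have : 0 ≤ 1 - x := by linarith [hx.2]
    simp only [Pi.zero_apply]
    positivity

/-- The product space on which the limiting degree of a late vertex is realised as the product of
a half-normal variable and the square root of a beta variable. -/
def halfNormalBeta (p : ℕ) : Measure (ℝ × ℝ) :=
  halfNormal.prod (ProbabilityTheory.betaMeasure 1 ((p + 1 : ℕ) : ℝ))

lemma lintegral_pow_halfNormalBeta (p m : ℕ) :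
    ∫⁻ a, ENNReal.ofReal ((|a.1| * √a.2) ^ m) ∂halfNormalBeta p =
      ENNReal.ofReal (m.factorial * limitMoment (p + 2) m) := by
  have := ProbabilityTheory.isProbabilityMeasureBeta one_pos
    (show (0 : ℝ) < ((p + 1 : ℕ) : ℝ) by positivity)
  have heq : ∀ a : ℝ × ℝ, ENNReal.ofReal ((|a.1| * √a.2) ^ m) =
      ENNReal.ofReal (|a.1| ^ m) * ENNReal.ofReal (√a.2 ^ m) := fun a => by
    rw [mul_pow, ENNReal.ofReal_mul (by positivity)]
  simp_rw [heq]
  have hG : Real.Gamma (1 + (m : ℝ) / 2) ≠ 0 := (Real.Gamma_pos_of_pos (by positivity)).ne'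
  rw [halfNormalBeta, lintegral_prod_mul (f := fun x : ℝ => ENNReal.ofReal (|x| ^ m))
    (g := fun x : ℝ => ENNReal.ofReal (√x ^ m)) (by fun_prop) (by fun_prop),
    lintegral_abs_pow_halfNormal, lintegral_sqrt_pow_betaMeasure (by positivity),
    ← ENNReal.ofReal_mul
      (div_nonneg (by positivity) (Real.Gamma_nonneg_of_nonneg (by positivity))), limitMoment]
  congr 1
  rw [show (1 : ℝ) + ((p + 1 : ℕ) : ℝ) = ((p + 2 : ℕ) : ℝ) by push_cast; ring,
    show (1 : ℝ) + m / 2 + ((p + 1 : ℕ) : ℝ) = ((p + 2 : ℕ) : ℝ) + m / 2 by push_cast; ring]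
  field_simp

lemma measurable_halfNormalBeta : Measurable fun a : ℝ × ℝ => |a.1| * √a.2 := by fun_prop

lemma halfNormalBeta_tail_le (p : ℕ) {t : ℝ} (ht : 0 < t) :
    (halfNormalBeta p).map (fun a => |a.1| * √a.2) (Set.Ioi t) ≤
      ∫⁻ x in Set.Ioi t, ENNReal.ofReal (Real.exp (-x ^ 2 / 4) / √Real.pi) *
        ENNReal.ofReal ((1 - (t / x) ^ 2) ^ (p + 1)) := by
  have := ProbabilityTheory.isProbabilityMeasureBeta one_pos
    (show (0 : ℝ) < ((p + 1 : ℕ) : ℝ) by positivity)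
  have hmeas := measurable_halfNormalBeta (measurableSet_Ioi (a := t))
  rw [Measure.map_apply measurable_halfNormalBeta measurableSet_Ioi, halfNormalBeta,
    Measure.prod_apply hmeas, lintegral_halfNormal (measurable_measure_prodMk_left hmeas),
    ← lintegral_indicator measurableSet_Ioi, ← lintegral_indicator measurableSet_Ioi]
  refine lintegral_mono fun x => ?_
  rcases le_or_gt x 0 with hx | hx
  · simp [hx]
  rw [Set.indicator_of_mem (show x ∈ Set.Ioi 0 from hx)]
  have hsub : Prod.mk x ⁻¹' ((fun a : ℝ × ℝ => |a.1| * √a.2) ⁻¹' Set.Ioi t) ⊆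
      Set.Ioi ((t / x) ^ 2) := by
    intro b hb
    simp only [Set.mem_preimage, Set.mem_Ioi, abs_of_pos hx] at hb ⊢
    rw [← Real.lt_sqrt (by positivity), div_lt_iff₀ hx]
    linarith
  rcases le_or_gt x t with hxt | hxt
  · have h1 : (1 : ℝ) ≤ (t / x) ^ 2 := one_le_pow₀ ((one_le_div hx).2 hxt)
    have h0 := (measure_mono (hsub.trans (Set.Ioi_subset_Ioi h1))).trans
      (betaMeasure_one_Ioi_le p zero_le_one le_rfl)
    rw [sub_self, zero_pow (Nat.succ_ne_zero p), ENNReal.ofReal_zero, nonpos_iff_eq_zero] at h0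
    rw [h0, mul_zero]
    exact zero_le
  · rw [Set.indicator_of_mem (show x ∈ Set.Ioi t from hxt)]
    gcongr
    refine (measure_mono hsub).trans (betaMeasure_one_Ioi_le p (by positivity) ?_)
    exact pow_le_one₀ (by positivity) ((div_le_one hx).2 hxt.le)

/-- Identification of the law of the limiting degree of a vertex outside of the seed. -/
lemma map_limit_eq_halfNormalBeta {k : ℕ} {T : SimpleGraph ℕ} {Ω : Type} [MeasurableSpace Ω]
    {P : Measure Ω} [IsProbabilityMeasure P] {X : ℕ → Ω → SimpleGraph ℕ} {D : Ω → ℝ} {p : ℕ}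
    (hk : 2 ≤ k) (hT : IsTreeOn k T) (hX : ∀ n : ℕ, k ≤ n → P.map (X n) = PAlaw k T n)
    (hv : k ≤ p + 2)
    (hD : ∀ᵐ ω ∂P,
      Tendsto (fun n : ℕ => (degN (X n ω) (p + 2) : ℝ) / √(n : ℝ)) atTop (nhds (D ω))) :
    P.map D = (halfNormalBeta p).map fun a => |a.1| * √a.2 := by
  have hfin : IsFiniteMeasure (halfNormalBeta p) := by
    refine ⟨?_⟩
    have h := lintegral_pow_halfNormalBeta p 0
    simp only [pow_zero, ENNReal.ofReal_one, lintegral_const, one_mul] at h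
    rw [h]
    exact ENNReal.ofReal_lt_top
  refine Measure.ext_of_charFun (funext fun s => ?_)
  rw [charFun_limit hk hT hX hv hD,
    charFun_map_eq_tsum_of_moments measurable_halfNormalBeta (fun a => by positivity)
      (limitMoment_nonneg (p + 2)) (lintegral_pow_halfNormalBeta p)
      (summable_pow_mul_limitMoment (by omega) (abs_nonneg s))]

lemma tsum_geometric_weight {t x : ℝ} (ht : 0 < t) (hx : t < x) (q : ℕ) :
    ∑' i : ℕ, ENNReal.ofReal ((1 - (t / x) ^ 2) ^ (q + i)) =
      ENNReal.ofReal ((1 - (t / x) ^ 2) ^ q * (x / t) ^ 2) := by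
  have hx0 : 0 < x := ht.trans hx
  have hr1 : (t / x) ^ 2 ≤ 1 := pow_le_one₀ (by positivity) ((div_le_one hx0).2 hx.le)
  have hr : 0 ≤ 1 - (t / x) ^ 2 := by linarith
  have hlt : 1 - (t / x) ^ 2 < 1 := by
    have : 0 < (t / x) ^ 2 := by positivity
    linarith
  have hg := (hasSum_geometric_of_lt_one hr hlt).mul_left ((1 - (t / x) ^ 2) ^ q)
  rw [← ENNReal.ofReal_tsum_of_nonneg (fun i => pow_nonneg hr _)]
  · congr 1
    simp_rw [pow_add]
    rw [hg.tsum_eq, sub_sub_cancel, ← inv_pow, inv_div]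
  · simpa only [pow_add] using hg.summable

lemma gaussian_weight_le {t x : ℝ} (ht : 0 < t) (hx : t < x) (p : ℕ) :
    Real.exp (-x ^ 2 / 4) / √Real.pi * ((1 - (t / x) ^ 2) ^ (p + 1) * (x / t) ^ 2) ≤
      8 ^ (p + 1) * (p + 1).factorial * (t ^ (2 * (p + 1)))⁻¹ * Real.exp (-t ^ 2 / 4) *
        Real.exp (-(t / 4) * (x - t)) := by
  have hx0 : 0 < x := ht.trans hx
  set u := x ^ 2 - t ^ 2 with hu
  have hu0 : 0 ≤ u := by
    rw [hu]
    nlinarith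
  have hw : (1 - (t / x) ^ 2) ^ (p + 1) * (x / t) ^ 2 =
      u ^ (p + 1) * ((x ^ (2 * p))⁻¹ * (t ^ 2)⁻¹) := by
    have : 1 - (t / x) ^ 2 = u / x ^ 2 := by
      rw [hu]
      field_simp
    rw [this, div_pow, div_pow, ← pow_mul, mul_add, pow_add x]
    field_simp
  have hexp : Real.exp (-x ^ 2 / 4) * u ^ (p + 1) ≤
      8 ^ (p + 1) * (p + 1).factorial *
        (Real.exp (-t ^ 2 / 4) * Real.exp (-(t / 4) * (x - t))) := by
    have h1 : u ^ (p + 1) ≤ 8 ^ (p + 1) * (p + 1).factorial * Real.exp (u / 8) := by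
      have := Real.pow_div_factorial_le_exp (u / 8) (by positivity) (p + 1)
      rw [div_pow, div_div, div_le_iff₀ (by positivity)] at this
      linarith
    calc _ ≤ Real.exp (-x ^ 2 / 4) * (8 ^ (p + 1) * (p + 1).factorial * Real.exp (u / 8)) := by
          gcongr
      _ = 8 ^ (p + 1) * (p + 1).factorial * Real.exp (-x ^ 2 / 4 + u / 8) := by
          rw [Real.exp_add]
          ring
      _ ≤ _ := by
          rw [← Real.exp_add]
          refine mul_le_mul_of_nonneg_left (Real.exp_le_exp.2 ?_) (by positivity)
          rw [hu]
          nlinarith [sq_nonneg (x - t)]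
  have hsqrt : 1 ≤ √Real.pi := Real.one_le_sqrt.2 (by linarith [Real.pi_gt_three])
  have hpow : (x ^ (2 * p))⁻¹ * (t ^ 2)⁻¹ ≤ (t ^ (2 * (p + 1)))⁻¹ := by
    rw [mul_add, pow_add, mul_inv]
    gcongr
  calc _ = Real.exp (-x ^ 2 / 4) * u ^ (p + 1) / √Real.pi * ((x ^ (2 * p))⁻¹ * (t ^ 2)⁻¹) := by
        rw [hw]
        ring
    _ ≤ Real.exp (-x ^ 2 / 4) * u ^ (p + 1) * (t ^ (2 * (p + 1)))⁻¹ := by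
        gcongr
        exact div_le_self (by positivity) hsqrt
    _ ≤ _ := by
        refine (mul_le_mul_of_nonneg_right hexp (by positivity)).trans_eq ?_
        ring

lemma lintegral_exp_neg_mul_sub {a : ℝ} (ha : 0 < a) (t : ℝ) :
    ∫⁻ x in Set.Ioi t, ENNReal.ofReal (Real.exp (-a * (x - t))) = ENNReal.ofReal (1 / a) := by
  have heq : ∀ x : ℝ, Real.exp (-a * (x - t)) = Real.exp (a * t) * Real.exp (-a * x) := fun x => by
    rw [← Real.exp_add]
    ring_nf
  simp_rw [heq]
  rw [← ofReal_integral_eq_lintegral_ofReal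
    ((integrableOn_exp_mul_Ioi (by linarith) t).const_mul _)
    (Eventually.of_forall fun x => by positivity), integral_const_mul,
    integral_exp_mul_Ioi (by linarith)]
  congr 1
  have : Real.exp (a * t) * Real.exp (-a * t) = 1 := by
    rw [← Real.exp_add]
    simp
  rw [neg_div_neg_eq, mul_div_assoc', this]

lemma tsum_halfNormalBeta_tail_le (p : ℕ) {t : ℝ} (ht : 0 < t) :
    ∑' i : ℕ, (halfNormalBeta (p + i)).map (fun a => |a.1| * √a.2) (Set.Ioi t) ≤
      ENNReal.ofReal (8 ^ (p + 1) * (p + 1).factorial * (t ^ (2 * (p + 1)))⁻¹ *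
        Real.exp (-t ^ 2 / 4) * (4 / t)) := by
  calc _ ≤ ∑' i : ℕ, ∫⁻ x in Set.Ioi t, ENNReal.ofReal (Real.exp (-x ^ 2 / 4) / √Real.pi) *
        ENNReal.ofReal ((1 - (t / x) ^ 2) ^ (p + 1 + i)) :=
        ENNReal.tsum_le_tsum fun i => by
          have := halfNormalBeta_tail_le (p + i) ht
          rwa [add_right_comm] at this
    _ = ∫⁻ x in Set.Ioi t, ∑' i : ℕ, ENNReal.ofReal (Real.exp (-x ^ 2 / 4) / √Real.pi) *
        ENNReal.ofReal ((1 - (t / x) ^ 2) ^ (p + 1 + i)) :=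
        (lintegral_tsum fun i => by fun_prop).symm
    _ ≤ ∫⁻ x in Set.Ioi t, ENNReal.ofReal (8 ^ (p + 1) * (p + 1).factorial *
          (t ^ (2 * (p + 1)))⁻¹ * Real.exp (-t ^ 2 / 4)) *
          ENNReal.ofReal (Real.exp (-(t / 4) * (x - t))) := by
        refine setLIntegral_mono' measurableSet_Ioi fun x hx => ?_
        rw [ENNReal.tsum_mul_left, tsum_geometric_weight ht hx,
          ← ENNReal.ofReal_mul (by positivity), ← ENNReal.ofReal_mul (by positivity)]
        exact ENNReal.ofReal_le_ofReal (gaussian_weight_le ht hx p)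
    _ = _ := by
        rw [lintegral_const_mul _ (by fun_prop), lintegral_exp_neg_mul_sub (by positivity),
          ← ENNReal.ofReal_mul (by positivity), one_div_div]

/-- Tail bound for the limiting rescaled degrees of late vertices: if `T` is a seed tree
on `k ≥ 2` vertices and `L > k` (vertices indexed from `1` in the paper; vertex `i` of the
paper is vertex `i - 1` here), then there is a constant `C(L) < ∞` with
`∑_{i=L}^∞ P(D_i(T) > t) ≤ C(L) t^(3-2L) exp(-t²/4)` for all `t ≥ 1`. -/
theorem tail_sum_late_degrees
    (k : ℕ) (hk : 2 ≤ k) (T : SimpleGraph ℕ) (hT : IsTreeOn k T)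
    {Ω : Type} [MeasurableSpace Ω] (P : Measure Ω) [IsProbabilityMeasure P]
    (X : ℕ → Ω → SimpleGraph ℕ)
    (hX : ∀ n : ℕ, k ≤ n → P.map (X n) = PAlaw k T n)
    (D : ℕ → Ω → ℝ)
    (hD : ∀ i : ℕ, ∀ᵐ ω ∂P,
      Filter.Tendsto (fun n : ℕ => (degN (X n ω) i : ℝ) / Real.sqrt n)
        Filter.atTop (nhds (D i ω)))
    (L : ℕ) (hL : k < L) :
    ∃ C : ℝ, ∀ t : ℝ, 1 ≤ t →
      (∑' i : ℕ, P {ω | t < D (L - 1 + i) ω}) ≤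
        ENNReal.ofReal (C * t ^ ((3 : ℝ) - 2 * L) * Real.exp (-t ^ 2 / 4)) := by
  obtain ⟨p, rfl⟩ : ∃ p, L = p + 3 := ⟨L - 3, by omega⟩
  refine ⟨8 ^ (p + 1) * (p + 1).factorial * 4, fun t ht => ?_⟩
  have ht0 : 0 < t := by linarith
  have hterm : ∀ i : ℕ, P {ω | t < D (p + 3 - 1 + i) ω} =
      (halfNormalBeta (p + i)).map (fun a => |a.1| * √a.2) (Set.Ioi t) := by
    intro i
    rw [show p + 3 - 1 + i = p + i + 2 by omega]
    have hv : k ≤ p + i + 2 := by omega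
    rw [← map_limit_eq_halfNormalBeta hk hT hX hv (hD _), Measure.map_apply_of_aemeasurable
      (aemeasurable_limit hk hT hX hv (hD _)) measurableSet_Ioi]
    rfl
  rw [tsum_congr hterm]
  refine (tsum_halfNormalBeta_tail_le p ht0).trans_eq ?_
  congr 1
  have hpow : t ^ ((3 : ℝ) - 2 * ((p + 3 : ℕ) : ℝ)) = (t ^ (2 * (p + 1)))⁻¹ * t⁻¹ := by
    rw [show (3 : ℝ) - 2 * ((p + 3 : ℕ) : ℝ) = -((2 * (p + 1) + 1 : ℕ) : ℝ) by push_cast; ring,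
      Real.rpow_neg ht0.le, Real.rpow_natCast, pow_succ, mul_inv]
  rw [hpow]
  ring


end
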